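/- Let M be a torsion left module over a principal ideal domain R. Then M has a proper essential submodule if and only if there exist a prime p of R and positive integers i < j such that Ann_M(p^i) is strictly contained in Ann_M(p^j). -/

import Mathlib

/-- `E` is a proper essential submodule of `M`: a proper nontrivial submodule that
intersects every nonzero submodule nontrivially. -/
def IsProperEssential {R M : Type*} [Ring R] [AddCommGroup M] [Module R M]
    (E : Submodule R M) : Prop :=
  E ≠ ⊥ ∧ E ≠ ⊤ ∧ ∀ N : Submodule R M, N ≠ ⊥ → E ⊓ N ≠ ⊥

theorem aux_exists_prime_torsion {R M : Type*} [CommRing R] [IsDomain R]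
    [IsPrincipalIdealRing R] [AddCommGroup M] [Module R M] (r : R) (hr : r ≠ 0) (m : M)
    (hm : m ≠ 0) (h : r • m = 0) : ∃ q c : R, Prime q ∧ c • m ≠ 0 ∧ q • c • m = 0 := by
  induction r using UniqueFactorizationMonoid.induction_on_prime with
  | h₁ => exact absurd rfl hr
  | h₂ x hx => exact absurd ((hx.smul_eq_zero).1 h) hm
  | h₃ a q ha hq ih =>
    by_cases h0 : a • m = 0
    · exact ih ha h0
    · exact ⟨q, a, hq, h0, by rwa [smul_smul]⟩

theorem aux_coprime {R : Type*} [CommRing R] [IsDomain R]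
    [IsPrincipalIdealRing R] {p s : R} (hp : Prime p) (h : ¬ p ∣ s) : IsCoprime p s :=
  (hp.irreducible.coprime_iff_not_dvd).2 h

theorem aux_mem_essential {R M : Type*} [CommRing R] [IsDomain R]
    [IsPrincipalIdealRing R] [AddCommGroup M] [Module R M] (E : Submodule R M)
    (hE : ∀ N : Submodule R M, N ≠ ⊥ → E ⊓ N ≠ ⊥)
    (hsq : ∀ p : R, Prime p → ∀ m : M, p • p • m = 0 → p • m = 0)
    (r : R) (hr : r ≠ 0) (m : M) (h : r • m = 0) : m ∈ E := by
  have key : ∀ q : R, Prime q → ∀ n : M, q • n = 0 → n ∈ E := by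
    intro q hq n hn
    by_cases hn0 : n = 0
    · rw [hn0]; exact E.zero_mem
    obtain ⟨y, hy, hy0⟩ := (Submodule.ne_bot_iff _).1
      (hE (Submodule.span R {n}) (by simpa using hn0))
    obtain ⟨hyE, hyn⟩ := hy
    obtain ⟨c, rfl⟩ := Submodule.mem_span_singleton.1 hyn
    have hc : ¬ q ∣ c := by
      rintro ⟨d, rfl⟩
      exact hy0 (by rw [mul_comm, mul_smul, hn, smul_zero])
    obtain ⟨u, v, huv⟩ := aux_coprime hq hc
    have : n = v • c • n := by
      calc n = (u * q + v * c) • n := by rw [huv, one_smul]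
        _ = v • c • n := by rw [add_smul, mul_smul, hn, smul_zero, zero_add, mul_smul]
    rw [this]
    exact E.smul_mem v hyE
  induction r using UniqueFactorizationMonoid.induction_on_prime generalizing m with
  | h₁ => exact absurd rfl hr
  | h₂ x hx => rw [(hx.smul_eq_zero).1 h]; exact E.zero_mem
  | h₃ a q ha hq ih =>
    by_cases hd : q ∣ a
    · obtain ⟨b, rfl⟩ := hd
      refine ih ha m ?_
      rw [mul_smul]
      apply hsq q hq
      rw [← mul_smul q b, ← mul_smul]
      exact h
    · obtain ⟨u, v, huv⟩ := aux_coprime hq hd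
      have : m = u • q • m + v • a • m := by
        calc m = (u * q + v * a) • m := by rw [huv, one_smul]
          _ = _ := by rw [add_smul, mul_smul, mul_smul]
      rw [this]
      refine E.add_mem (E.smul_mem u (ih ha _ ?_)) (E.smul_mem v (key q hq _ ?_))
      · rwa [smul_smul, mul_comm]
      · rwa [smul_smul]

/-- A torsion module over a PID has a proper essential submodule iff for some prime `p`
and positive integers `i < j` the submodule `Ann_M(pⁱ)` is strictly contained in
`Ann_M(pʲ)`. -/
theorem torsion_pid_properEssential_iff {R M : Type*} [CommRing R] [IsDomain R]
    [IsPrincipalIdealRing R] [AddCommGroup M] [Module R M]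
    (htor : ∀ m : M, ∃ r : R, r ≠ 0 ∧ r • m = 0) :
    (∃ E : Submodule R M, IsProperEssential E) ↔
      ∃ p : R, Prime p ∧ ∃ i j : ℕ, 0 < i ∧ i < j ∧
        Submodule.torsionBy R M (p ^ i) < Submodule.torsionBy R M (p ^ j) := by
  constructor
  · rintro ⟨E, -, hT, hE⟩
    by_contra hno
    apply hT
    rw [eq_top_iff]
    intro m _
    obtain ⟨r, hr, hrm⟩ := htor m
    refine aux_mem_essential E hE ?_ r hr m hrm
    intro p hp n hn
    by_contra hn1
    refine hno ⟨p, hp, 1, 2, one_pos, one_lt_two, ?_⟩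
    refine lt_of_le_of_ne (Submodule.torsionBy_le_torsionBy_of_dvd _ _
      (pow_dvd_pow p one_le_two)) ?_
    intro heq
    have h2 : n ∈ Submodule.torsionBy R M (p ^ 2) := by
      rw [Submodule.mem_torsionBy_iff, pow_two, mul_smul, hn]
    rw [← heq, Submodule.mem_torsionBy_iff, pow_one] at h2
    exact hn1 h2
  · rintro ⟨p, hp, i, j, hi, -, hlt⟩
    obtain ⟨-, x, hxj, hxi⟩ := SetLike.lt_iff_le_and_exists.1 hlt
    rw [Submodule.mem_torsionBy_iff] at hxj hxi
    let E : Submodule R M :=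
      { carrier := {m | ∃ s : R, ¬ p ∣ s ∧ (s * p) • m = 0}
        zero_mem' := ⟨1, hp.not_dvd_one, smul_zero _⟩
        add_mem' := by
          rintro a b ⟨s, hs, hsa⟩ ⟨t, ht, htb⟩
          refine ⟨s * t, hp.not_dvd_mul hs ht, ?_⟩
          rw [smul_add, show s * t * p = t * (s * p) by ring, mul_smul, hsa,
            show t * (s * p) = s * (t * p) by ring, mul_smul s, htb]
          simp
        smul_mem' := by
          rintro c a ⟨s, hs, hsa⟩
          exact ⟨s, hs, by rw [smul_comm, hsa, smul_zero]⟩ }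
    have hmem : ∀ m : M, m ∈ E ↔ ∃ s : R, ¬ p ∣ s ∧ (s * p) • m = 0 := fun _ => Iff.rfl
    have hess : ∀ N : Submodule R M, N ≠ ⊥ → E ⊓ N ≠ ⊥ := by
      intro N hN
      obtain ⟨m, hmN, hm0⟩ := (Submodule.ne_bot_iff _).1 hN
      obtain ⟨r, hr, hrm⟩ := htor m
      obtain ⟨q, c, hq, hc, hqc⟩ := aux_exists_prime_torsion r hr m hm0 hrm
      refine (Submodule.ne_bot_iff _).2 ⟨c • m, ⟨?_, N.smul_mem c hmN⟩, hc⟩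
      refine (hmem _).2 ?_
      by_cases hpq : p ∣ q
      · obtain ⟨u, rfl⟩ := (hp.associated_of_dvd hq hpq)
        refine ⟨1, hp.not_dvd_one, ?_⟩
        rw [mul_comm, mul_smul] at hqc
        rw [one_mul]
        exact (u.isUnit.smul_eq_zero).1 hqc
      · exact ⟨q, hpq, by rw [mul_comm, mul_smul, hqc, smul_zero]⟩
    refine ⟨E, ?_, ?_, hess⟩
    · intro h
      refine hess ⊤ ?_ (by rw [h, bot_inf_eq])
      refine (Submodule.ne_bot_iff _).2 ⟨x, trivial, ?_⟩
      rintro rfl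
      exact hxi (smul_zero _)
    · intro h
      obtain ⟨s, hs, hsx⟩ := (hmem x).1 (h ▸ trivial)
      apply hxi
      obtain ⟨u, v, huv⟩ := (aux_coprime hp hs).pow_left (m := j)
      obtain ⟨k, rfl⟩ : ∃ k, i = k + 1 := ⟨i - 1, by omega⟩
      calc p ^ (k + 1) • x = ((u * p ^ j + v * s) * p ^ (k + 1)) • x := by rw [huv, one_mul]
        _ = (u * p ^ (k + 1)) • p ^ j • x + (v * p ^ k) • (s * p) • x := by
            rw [smul_smul, smul_smul, ← add_smul]; congr 1; ring
        _ = 0 := by rw [hxj, hsx, smul_zero, smul_zero, add_zero]
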